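/- arXiv:1701.06798 — 2 statements merged into one kernel-verified Lean document; each statement's English description precedes it below -/
import Mathlib

section
/- Let G be an abelian group with neutral element e. Every G-grading on K₃ × K₃ is isomorphic either to Γ¹(G;g₁,g₂) for some g₁,g₂ ∈ G, or to Γ²(G;g,h) for some g,h ∈ G with h² = e ≠ h. -/
open scoped TensorProduct
noncomputable section
namespace Kac

/-! ### Superalgebra isomorphisms and automorphisms -/

@[ext]
structure SuperIso (S A B : Type) [CommRing S]
    [AddCommGroup A] [Module S A] [Mul A]
    [AddCommGroup B] [Module S B] [Mul B]
    (evA odA : Submodule S A) (evB odB : Submodule S B) : Type where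
  e : A ≃ₗ[S] B
  map_mul' : ∀ x y : A, e (x * y) = e x * e y
  map_even : evA.map e.toLinearMap = evB
  map_odd : odA.map e.toLinearMap = odB

abbrev SuperAut (S A : Type) [CommRing S] [AddCommGroup A] [Module S A] [Mul A]
    (ev od : Submodule S A) := SuperIso S A A ev od ev od

namespace SuperAut

variable {S A : Type} [CommRing S] [AddCommGroup A] [Module S A] [Mul A]
variable {ev od : Submodule S A}

private lemma map_symm {f : A ≃ₗ[S] A} {p : Submodule S A}
    (h : p.map f.toLinearMap = p) : p.map f.symm.toLinearMap = p := by
  have h2 : f.symm.toLinearMap.comp f.toLinearMap = LinearMap.id := by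
    ext x; simp
  calc p.map f.symm.toLinearMap
      = (p.map f.toLinearMap).map f.symm.toLinearMap := by rw [h]
    _ = p.map (f.symm.toLinearMap.comp f.toLinearMap) := by
        rw [Submodule.map_comp]
    _ = p := by rw [h2, Submodule.map_id]

instance : Group (SuperAut S A ev od) where
  one := ⟨LinearEquiv.refl S A, fun _ _ => rfl, Submodule.map_id _, Submodule.map_id _⟩
  mul f g := ⟨g.e.trans f.e,
    fun x y => by simp [LinearEquiv.trans_apply, g.map_mul', f.map_mul'],
    by rw [LinearEquiv.coe_trans, Submodule.map_comp, g.map_even, f.map_even],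
    by rw [LinearEquiv.coe_trans, Submodule.map_comp, g.map_odd, f.map_odd]⟩
  inv f := ⟨f.e.symm,
    fun x y => f.e.injective <| by simp [f.map_mul'],
    map_symm f.map_even, map_symm f.map_odd⟩
  mul_assoc f g h := by apply SuperIso.ext; apply LinearEquiv.ext; intro x; rfl
  one_mul f := by apply SuperIso.ext; apply LinearEquiv.ext; intro x; rfl
  mul_one f := by apply SuperIso.ext; apply LinearEquiv.ext; intro x; rfl
  inv_mul_cancel f := by
    apply SuperIso.ext; apply LinearEquiv.ext; intro x
    exact f.e.symm_apply_apply x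

end SuperAut

/-- The predicate that a pair of submodules `ev`, `od` makes a non-unital
(possibly non-associative) algebra `B` into a superalgebra. -/
def IsSuperalgebra (S B : Type) [CommRing S] [NonUnitalNonAssocRing B] [Module S B]
    (ev od : Submodule S B) : Prop :=
  ev ⊔ od = ⊤ ∧ ev ⊓ od = ⊥ ∧
  (∀ x ∈ ev, ∀ y ∈ ev, x * y ∈ ev) ∧ (∀ x ∈ ev, ∀ y ∈ od, x * y ∈ od) ∧
  (∀ x ∈ od, ∀ y ∈ ev, x * y ∈ od) ∧ (∀ x ∈ od, ∀ y ∈ od, x * y ∈ ev)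

/-! ### Submodules given by vanishing of coordinates -/

def stdSub (S R : Type) [Semiring S] [AddCommGroup R] [Module S R] (n : ℕ)
    (s : Set (Fin n)) : Submodule S (Fin n → R) where
  carrier := {x | ∀ i, i ∉ s → x i = 0}
  add_mem' := fun {a b} ha hb i hi => by
    simp [Pi.add_apply, ha i hi, hb i hi]
  zero_mem' := fun i _ => rfl
  smul_mem' := fun c x hx i hi => by
    simp [Pi.smul_apply, hx i hi]

/-! ### Gradings by abelian groups -/

section Gradings

variable {G H S A : Type} [CommGroup G] [CommGroup H] [CommRing S]
  [AddCommGroup A] [Module S A] [Mul A]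

/-- `comp` is a `G`-grading of the superalgebra `(A, ev, od)`. -/
def IsSuperGrading (ev od : Submodule S A) (comp : G → Submodule S A) : Prop :=
  (letI := Classical.decEq G; DirectSum.IsInternal comp) ∧
  (∀ (g h : G) (x y : A), x ∈ comp g → y ∈ comp h → x * y ∈ comp (g * h)) ∧
  (∀ g, comp g = (comp g ⊓ ev) ⊔ (comp g ⊓ od))

/-- The grading with homogeneous elements `w i` of degrees `d i`. -/
def gradingOf (S : Type) {A G : Type} [CommRing S] [AddCommGroup A] [Module S A]
    [CommGroup G] {n : ℕ} (w : Fin n → A) (d : Fin n → G) : G → Submodule S A :=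
  fun g => Submodule.span S (w '' {i | d i = g})

/-- Isomorphism of two `G`-gradings on a superalgebra. -/
def GradIso (ev od : Submodule S A) (comp comp' : G → Submodule S A) : Prop :=
  ∃ φ : SuperAut S A ev od, ∀ g, (comp g).map φ.e.toLinearMap = comp' g

/-- `Δ` refines `Γ`. -/
def Refines (Δ : H → Submodule S A) (Γ : G → Submodule S A) : Prop :=
  ∀ h, Δ h ≠ ⊥ → ∃ g, Δ h ≤ Γ g

/-- Equivalence of a `G`-grading and an `H`-grading on a superalgebra. -/
def GradEquiv (ev od : Submodule S A) (Γ : G → Submodule S A)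
    (Δ : H → Submodule S A) : Prop :=
  ∃ φ : SuperAut S A ev od, ∃ α : {g : G // Γ g ≠ ⊥} → {h : H // Δ h ≠ ⊥},
    Function.Bijective α ∧
    ∀ g : {g : G // Γ g ≠ ⊥}, (Γ g.1).map φ.e.toLinearMap = Δ (α g).1

/-- A grading is fine if any grading refining it has the same nonzero
homogeneous components. -/
def IsFine (ev od : Submodule S A) (Γ : G → Submodule S A) : Prop :=
  ∀ (H : Type) (_ : CommGroup H) (Δ : H → Submodule S A),
    IsSuperGrading ev od Δ → Refines Δ Γ →
      {p : Submodule S A | p ≠ ⊥ ∧ ∃ h, Δ h = p} =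
      {p : Submodule S A | p ≠ ⊥ ∧ ∃ g, Γ g = p}

end Gradings

/-! ### SL₂ and the semidirect product with C₂ -/

abbrev SL2 (R : Type) [CommRing R] := Matrix.SpecialLinearGroup (Fin 2) R

def swapAut (M : Type) [Monoid M] : MulAut (M × M) := MulEquiv.prodComm

lemma swapAut_sq (M : Type) [Monoid M] : swapAut M * swapAut M = 1 :=
  MulEquiv.ext fun _ => rfl

/-- The action of `C₂ = Multiplicative (ZMod 2)` on `M × M` by swapping the factors. -/
def swapHom (M : Type) [Group M] : Multiplicative (ZMod 2) →* MulAut (M × M) :=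
  MonoidHom.mk' (fun c => if c.toAdd = 0 then 1 else swapAut M) (by
    intro a b
    have key : ∀ c : Multiplicative (ZMod 2),
        c = Multiplicative.ofAdd 0 ∨ c = Multiplicative.ofAdd 1 := by decide
    rcases key a with rfl | rfl <;> rcases key b with rfl | rfl <;>
      simp [← ofAdd_add, swapAut_sq] <;> exact fun h => absurd (by decide) h)

end Kac
/-! ### The (base-changed) Kaplansky superalgebra `K₃ ⊗ R` -/

namespace Kac

section Algebras

variable (F : Type) [Field F] (R : Type) [CommRing R] [Algebra F R]

/-- Coordinates: `0 ↦ a`, `1 ↦ u`, `2 ↦ v`. -/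
def K3A (F : Type) [Field F] (R : Type) [CommRing R] [Algebra F R] : Type := Fin 3 → R

instance : AddCommGroup (K3A F R) := Pi.addCommGroup
instance (S : Type) [Semiring S] [Module S R] : Module S (K3A F R) := Pi.module _ _ _

namespace K3A
variable {F R}

def mulFun (x y : K3A F R) : K3A F R := fun i =>
  match i with
  | ⟨0, _⟩ => x 0 * y 0 + (x 1 * y 2 - x 2 * y 1)
  | ⟨1, _⟩ => algebraMap F R 2⁻¹ * (x 0 * y 1 + y 0 * x 1)
  | ⟨2, _⟩ => algebraMap F R 2⁻¹ * (x 0 * y 2 + y 0 * x 2)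

instance : Mul (K3A F R) := ⟨mulFun⟩

lemma mul_def (x y : K3A F R) : x * y = mulFun x y := rfl

@[simp] lemma add_apply (x y : K3A F R) (i : Fin 3) : (x + y) i = x i + y i := rfl
@[simp] lemma sub_apply (x y : K3A F R) (i : Fin 3) : (x - y) i = x i - y i := rfl
@[simp] lemma neg_apply (x : K3A F R) (i : Fin 3) : (-x) i = -(x i) := rfl
@[simp] lemma zero_apply (i : Fin 3) : (0 : K3A F R) i = 0 := rfl
@[simp] lemma smul_apply (S : Type) [Semiring S] [Module S R] (c : S) (x : K3A F R) (i : Fin 3) :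
    (c • x) i = c • (x i) := rfl

variable (F R)

/-- The even part `R·a`. -/
def even (S : Type) [Semiring S] [Module S R] : Submodule S (K3A F R) := stdSub S R 3 {0}
/-- The odd part `W ⊗ R`. -/
def odd (S : Type) [Semiring S] [Module S R] : Submodule S (K3A F R) := stdSub S R 3 {1, 2}

/-- The element `a`. -/
def aE : K3A F R := ![1, 0, 0]
/-- The element of `W ⊗ R` with coordinates `w` in the symplectic basis `{u, v}`. -/
def wE (w : Fin 2 → R) : K3A F R := ![0, w 0, w 1]

end K3A

/-- `J(W) ⊗ R`; coordinates: `0 ↦ 1`, `1 ↦ u`, `2 ↦ v`. -/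
def JW1A (R : Type) [CommRing R] : Type := Fin 3 → R

instance : AddCommGroup (JW1A R) := Pi.addCommGroup
instance (S : Type) [Semiring S] [Module S R] : Module S (JW1A R) := Pi.module _ _ _

namespace JW1A
variable {R}

def mulFun (x y : JW1A R) : JW1A R := fun i =>
  match i with
  | ⟨0, _⟩ => x 0 * y 0 + (x 1 * y 2 - x 2 * y 1)
  | ⟨1, _⟩ => x 0 * y 1 + y 0 * x 1
  | ⟨2, _⟩ => x 0 * y 2 + y 0 * x 2

instance : Mul (JW1A R) := ⟨mulFun⟩

lemma mul_def (x y : JW1A R) : x * y = mulFun x y := rfl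

@[simp] lemma add_apply (x y : JW1A R) (i : Fin 3) : (x + y) i = x i + y i := rfl
@[simp] lemma sub_apply (x y : JW1A R) (i : Fin 3) : (x - y) i = x i - y i := rfl
@[simp] lemma neg_apply (x : JW1A R) (i : Fin 3) : (-x) i = -(x i) := rfl
@[simp] lemma zero_apply (i : Fin 3) : (0 : JW1A R) i = 0 := rfl
@[simp] lemma smul_apply (S : Type) [Semiring S] [Module S R] (c : S) (x : JW1A R) (i : Fin 3) :
    (c • x) i = c • (x i) := rfl

variable (R)

def even (S : Type) [Semiring S] [Module S R] : Submodule S (JW1A R) := stdSub S R 3 {0}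
def odd (S : Type) [Semiring S] [Module S R] : Submodule S (JW1A R) := stdSub S R 3 {1, 2}

def oneE : JW1A R := ![1, 0, 0]
def wE (w : Fin 2 → R) : JW1A R := ![0, w 0, w 1]

end JW1A

/-- `(K₃ × K₃) ⊗ R`; coordinates `0,1,2` for the first copy (`a,u,v`),
`3,4,5` for the second copy. -/
def K33A (F : Type) [Field F] (R : Type) [CommRing R] [Algebra F R] : Type := Fin 6 → R

instance : AddCommGroup (K33A F R) := Pi.addCommGroup
instance (S : Type) [Semiring S] [Module S R] : Module S (K33A F R) := Pi.module _ _ _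

namespace K33A
variable {F R}

def mulFun (x y : K33A F R) : K33A F R := fun i =>
  match i with
  | ⟨0, _⟩ => x 0 * y 0 + (x 1 * y 2 - x 2 * y 1)
  | ⟨1, _⟩ => algebraMap F R 2⁻¹ * (x 0 * y 1 + y 0 * x 1)
  | ⟨2, _⟩ => algebraMap F R 2⁻¹ * (x 0 * y 2 + y 0 * x 2)
  | ⟨3, _⟩ => x 3 * y 3 + (x 4 * y 5 - x 5 * y 4)
  | ⟨4, _⟩ => algebraMap F R 2⁻¹ * (x 3 * y 4 + y 3 * x 4)
  | ⟨5, _⟩ => algebraMap F R 2⁻¹ * (x 3 * y 5 + y 3 * x 5)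

instance : Mul (K33A F R) := ⟨mulFun⟩

lemma mul_def (x y : K33A F R) : x * y = mulFun x y := rfl

@[simp] lemma add_apply (x y : K33A F R) (i : Fin 6) : (x + y) i = x i + y i := rfl
@[simp] lemma sub_apply (x y : K33A F R) (i : Fin 6) : (x - y) i = x i - y i := rfl
@[simp] lemma neg_apply (x : K33A F R) (i : Fin 6) : (-x) i = -(x i) := rfl
@[simp] lemma zero_apply (i : Fin 6) : (0 : K33A F R) i = 0 := rfl
@[simp] lemma smul_apply (S : Type) [Semiring S] [Module S R] (c : S) (x : K33A F R) (i : Fin 6) :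
    (c • x) i = c • (x i) := rfl

variable (F R)

def even (S : Type) [Semiring S] [Module S R] : Submodule S (K33A F R) := stdSub S R 6 {0, 3}
def odd (S : Type) [Semiring S] [Module S R] : Submodule S (K33A F R) := stdSub S R 6 {1, 2, 4, 5}

/-- The element `(a, 0)`. -/
def aLeft : K33A F R := ![1, 0, 0, 0, 0, 0]
/-- The element `(0, a)`. -/
def aRight : K33A F R := ![0, 0, 0, 1, 0, 0]
/-- The element `(v, w)` of the odd part, `v, w ∈ W ⊗ R`. -/
def oddE (w w' : Fin 2 → R) : K33A F R := ![0, w 0, w 1, 0, w' 0, w' 1]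
/-- The exchange automorphism `(x, y) ↦ (y, x)`. -/
def swapFun (x : K33A F R) : K33A F R := fun i =>
  match i with
  | ⟨0, _⟩ => x 3
  | ⟨1, _⟩ => x 4
  | ⟨2, _⟩ => x 5
  | ⟨3, _⟩ => x 0
  | ⟨4, _⟩ => x 1
  | ⟨5, _⟩ => x 2

end K33A

/-- `(J(W) × J(W)) ⊗ R`. -/
def JW2A (R : Type) [CommRing R] : Type := Fin 6 → R

instance : AddCommGroup (JW2A R) := Pi.addCommGroup
instance (S : Type) [Semiring S] [Module S R] : Module S (JW2A R) := Pi.module _ _ _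

namespace JW2A
variable {R}

def mulFun (x y : JW2A R) : JW2A R := fun i =>
  match i with
  | ⟨0, _⟩ => x 0 * y 0 + (x 1 * y 2 - x 2 * y 1)
  | ⟨1, _⟩ => x 0 * y 1 + y 0 * x 1
  | ⟨2, _⟩ => x 0 * y 2 + y 0 * x 2
  | ⟨3, _⟩ => x 3 * y 3 + (x 4 * y 5 - x 5 * y 4)
  | ⟨4, _⟩ => x 3 * y 4 + y 3 * x 4
  | ⟨5, _⟩ => x 3 * y 5 + y 3 * x 5

instance : Mul (JW2A R) := ⟨mulFun⟩

lemma mul_def (x y : JW2A R) : x * y = mulFun x y := rfl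

@[simp] lemma add_apply (x y : JW2A R) (i : Fin 6) : (x + y) i = x i + y i := rfl
@[simp] lemma sub_apply (x y : JW2A R) (i : Fin 6) : (x - y) i = x i - y i := rfl
@[simp] lemma neg_apply (x : JW2A R) (i : Fin 6) : (-x) i = -(x i) := rfl
@[simp] lemma zero_apply (i : Fin 6) : (0 : JW2A R) i = 0 := rfl
@[simp] lemma smul_apply (S : Type) [Semiring S] [Module S R] (c : S) (x : JW2A R) (i : Fin 6) :
    (c • x) i = c • (x i) := rfl

variable (R)

def even (S : Type) [Semiring S] [Module S R] : Submodule S (JW2A R) := stdSub S R 6 {0, 3}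
def odd (S : Type) [Semiring S] [Module S R] : Submodule S (JW2A R) := stdSub S R 6 {1, 2, 4, 5}

/-- The element `(1, 0)`. -/
def oneLeft : JW2A R := ![1, 0, 0, 0, 0, 0]
/-- The element `(0, 1)`. -/
def oneRight : JW2A R := ![0, 0, 0, 1, 0, 0]
def oddE (w w' : Fin 2 → R) : JW2A R := ![0, w 0, w 1, 0, w' 0, w' 1]
def swapFun (x : JW2A R) : JW2A R := fun i =>
  match i with
  | ⟨0, _⟩ => x 3
  | ⟨1, _⟩ => x 4
  | ⟨2, _⟩ => x 5
  | ⟨3, _⟩ => x 0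
  | ⟨4, _⟩ => x 1
  | ⟨5, _⟩ => x 2

end JW2A

/-- Kac's superalgebra `K₁₀ ⊗ R`.  CoordinatesL `0 ↦ 1`, `1 ↦ a⊗a`,
`2 ↦ u⊗u`, `3 ↦ u⊗v`, `4 ↦ v⊗u`, `5 ↦ v⊗v`, `6 ↦ u⊗a`, `7 ↦ v⊗a`,
`8 ↦ a⊗u`, `9 ↦ a⊗v`. -/
def K10A (F : Type) [Field F] (R : Type) [CommRing R] [Algebra F R] : Type := Fin 10 → R

instance : AddCommGroup (K10A F R) := Pi.addCommGroup
instance (S : Type) [Semiring S] [Module S R] : Module S (K10A F R) := Pi.module _ _ _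

namespace K10A
variable {F R}

def mulFun (x y : K10A F R) : K10A F R := fun i =>
  match i with
  | ⟨0, _⟩ => x 0 * y 0 - algebraMap F R (3/16) * (x 1 * y 1)
      + algebraMap F R (3/4) * (x 2 * y 5 + x 5 * y 2 - x 3 * y 4 - x 4 * y 3)
      - algebraMap F R (3/8) * (x 6 * y 7 - x 7 * y 6 + x 8 * y 9 - x 9 * y 8)
  | ⟨1, _⟩ => x 0 * y 1 + x 1 * y 0 + x 1 * y 1
      - (x 2 * y 5 + x 5 * y 2 - x 3 * y 4 - x 4 * y 3)
      + (x 6 * y 7 - x 7 * y 6) + (x 8 * y 9 - x 9 * y 8)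
  | ⟨2, _⟩ => x 0 * y 2 + x 2 * y 0 + algebraMap F R 4⁻¹ * (x 1 * y 2 + x 2 * y 1)
      + algebraMap F R 4⁻¹ * (x 6 * y 8 - x 8 * y 6)
  | ⟨3, _⟩ => x 0 * y 3 + x 3 * y 0 + algebraMap F R 4⁻¹ * (x 1 * y 3 + x 3 * y 1)
      + algebraMap F R 4⁻¹ * (x 6 * y 9 - x 9 * y 6)
  | ⟨4, _⟩ => x 0 * y 4 + x 4 * y 0 + algebraMap F R 4⁻¹ * (x 1 * y 4 + x 4 * y 1)
      + algebraMap F R 4⁻¹ * (x 7 * y 8 - x 8 * y 7)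
  | ⟨5, _⟩ => x 0 * y 5 + x 5 * y 0 + algebraMap F R 4⁻¹ * (x 1 * y 5 + x 5 * y 1)
      + algebraMap F R 4⁻¹ * (x 7 * y 9 - x 9 * y 7)
  | ⟨6, _⟩ => x 0 * y 6 + x 6 * y 0 + algebraMap F R 2⁻¹ * (x 1 * y 6 + x 6 * y 1)
      + algebraMap F R 2⁻¹ * (x 2 * y 9 + x 9 * y 2) - algebraMap F R 2⁻¹ * (x 3 * y 8 + x 8 * y 3)
  | ⟨7, _⟩ => x 0 * y 7 + x 7 * y 0 + algebraMap F R 2⁻¹ * (x 1 * y 7 + x 7 * y 1)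
      + algebraMap F R 2⁻¹ * (x 4 * y 9 + x 9 * y 4) - algebraMap F R 2⁻¹ * (x 5 * y 8 + x 8 * y 5)
  | ⟨8, _⟩ => x 0 * y 8 + x 8 * y 0 + algebraMap F R 2⁻¹ * (x 1 * y 8 + x 8 * y 1)
      - algebraMap F R 2⁻¹ * (x 2 * y 7 + x 7 * y 2) + algebraMap F R 2⁻¹ * (x 4 * y 6 + x 6 * y 4)
  | ⟨9, _⟩ => x 0 * y 9 + x 9 * y 0 + algebraMap F R 2⁻¹ * (x 1 * y 9 + x 9 * y 1)
      - algebraMap F R 2⁻¹ * (x 3 * y 7 + x 7 * y 3) + algebraMap F R 2⁻¹ * (x 5 * y 6 + x 6 * y 5)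

instance : Mul (K10A F R) := ⟨mulFun⟩

lemma mul_def (x y : K10A F R) : x * y = mulFun x y := rfl

@[simp] lemma add_apply (x y : K10A F R) (i : Fin 10) : (x + y) i = x i + y i := rfl
@[simp] lemma sub_apply (x y : K10A F R) (i : Fin 10) : (x - y) i = x i - y i := rfl
@[simp] lemma neg_apply (x : K10A F R) (i : Fin 10) : (-x) i = -(x i) := rfl
@[simp] lemma zero_apply (i : Fin 10) : (0 : K10A F R) i = 0 := rfl
@[simp] lemma smul_apply (S : Type) [Semiring S] [Module S R] (c : S) (x : K10A F R) (i : Fin 10) :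
    (c • x) i = c • (x i) := rfl

variable (F R)

def even (S : Type) [Semiring S] [Module S R] : Submodule S (K10A F R) :=
  stdSub S R 10 {0, 1, 2, 3, 4, 5}
def odd (S : Type) [Semiring S] [Module S R] : Submodule S (K10A F R) :=
  stdSub S R 10 {6, 7, 8, 9}

/-- The unity `1`. -/
def oneE : K10A F R := ![1, 0, 0, 0, 0, 0, 0, 0, 0, 0]
/-- The element `a ⊗ a`. -/
def aaE : K10A F R := ![0, 1, 0, 0, 0, 0, 0, 0, 0, 0]
/-- The element `v ⊗ w ∈ W ⊗ W`. -/
def wwE (w w' : Fin 2 → R) : K10A F R :=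
  ![0, 0, w 0 * w' 0, w 0 * w' 1, w 1 * w' 0, w 1 * w' 1, 0, 0, 0, 0]
/-- The element `w ⊗ a`, `w ∈ W ⊗ R`. -/
def waE (w : Fin 2 → R) : K10A F R := ![0, 0, 0, 0, 0, 0, w 0, w 1, 0, 0]
/-- The element `a ⊗ w`, `w ∈ W ⊗ R`. -/
def awE (w : Fin 2 → R) : K10A F R := ![0, 0, 0, 0, 0, 0, 0, 0, w 0, w 1]
/-- The exchange automorphism `τ`, `τ(x ⊗ y) = (-1)^{|x||y|} y ⊗ x`. -/
def tauFun (x : K10A F R) : K10A F R := fun i =>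
  match i with
  | ⟨0, _⟩ => x 0
  | ⟨1, _⟩ => x 1
  | ⟨2, _⟩ => -x 2
  | ⟨3, _⟩ => -x 4
  | ⟨4, _⟩ => -x 3
  | ⟨5, _⟩ => -x 5
  | ⟨6, _⟩ => x 8
  | ⟨7, _⟩ => x 9
  | ⟨8, _⟩ => x 6
  | ⟨9, _⟩ => x 7

end K10A

end Algebras

end Kac

namespace Kac

section GradingDefs

variable (F : Type) [Field F] {G : Type} [CommGroup G]

/-- Standard basis of `K₃ × K₃` (`a₁, u₁, v₁, a₂, u₂, v₂`). -/
def K33A.bv (i : Fin 6) : K33A F F := Pi.single i 1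

/-- The grading `Γ¹(G; g₁, g₂)` on `K₃ × K₃`: all even elements have degree
`e`, `deg (u,0) = g₁ = deg (v,0)⁻¹`, `deg (0,u) = g₂ = deg (0,v)⁻¹`. -/
def K33A.gamma1 (g1 g2 : G) : G → Submodule F (K33A F F) :=
  gradingOf F (K33A.bv F) ![1, g1, g1⁻¹, 1, g2, g2⁻¹]

/-- The grading `Γ²(G; g, h)` on `K₃ × K₃` (`h² = e ≠ h`):
`deg (a,a) = e`, `deg (a,-a) = h`, `deg (u,u) = g = deg (v,v)⁻¹`,
`deg (u,-u) = gh = deg (v,-v)⁻¹`. -/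
def K33A.gamma2 (g h : G) : G → Submodule F (K33A F F) :=
  gradingOf F
    ![K33A.bv F 0 + K33A.bv F 3, K33A.bv F 0 - K33A.bv F 3,
      K33A.bv F 1 + K33A.bv F 4, K33A.bv F 2 + K33A.bv F 5,
      K33A.bv F 1 - K33A.bv F 4, K33A.bv F 2 - K33A.bv F 5]
    ![1, h, g, g⁻¹, g * h, g⁻¹ * h]

/-- Standard (homogeneous) basis of `K₁₀`:
`1, a⊗a, u⊗u, u⊗v, v⊗u, v⊗v, u⊗a, v⊗a, a⊗u, a⊗v`. -/
def K10A.bv (i : Fin 10) : K10A F F := Pi.single i 1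

/-- The grading `Γ¹_{K₁₀}(G; g₁, g₂)` on `K₁₀`, determined by
`deg (u⊗a) = g₁ = deg (v⊗a)⁻¹`, `deg (a⊗u) = g₂ = deg (a⊗v)⁻¹`. -/
def K10A.gamma1 (g1 g2 : G) : G → Submodule F (K10A F F) :=
  gradingOf F (K10A.bv F)
    ![1, 1, g1 * g2, g1 * g2⁻¹, g1⁻¹ * g2, g1⁻¹ * g2⁻¹, g1, g1⁻¹, g2, g2⁻¹]

/-- The grading `Γ²_{K₁₀}(G; g, h)` on `K₁₀` (`h² = e ≠ h`), determined by
`deg (u⊗a + a⊗u) = g = deg (v⊗a + a⊗v)⁻¹`,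
`deg (u⊗a - a⊗u) = gh = deg (v⊗a - a⊗v)⁻¹`. -/
def K10A.gamma2 (g h : G) : G → Submodule F (K10A F F) :=
  gradingOf F
    ![K10A.bv F 0, K10A.bv F 1, K10A.bv F 3 - K10A.bv F 4,
      K10A.bv F 3 + K10A.bv F 4, K10A.bv F 2, K10A.bv F 5,
      K10A.bv F 6 + K10A.bv F 8, K10A.bv F 7 + K10A.bv F 9,
      K10A.bv F 6 - K10A.bv F 8, K10A.bv F 7 - K10A.bv F 9]
    ![1, 1, 1, h, g * g * h, g⁻¹ * g⁻¹ * h, g, g⁻¹, g * h, g⁻¹ * h]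

end GradingDefs

end Kac

namespace Kac

section GradingLemmas

variable {G S A : Type} [CommGroup G] [CommRing S] [AddCommGroup A] [Module S A] [Mul A]
variable {ev od : Submodule S A} {Γ : G → Submodule S A}

namespace IsSuperGrading

lemma iSupIndep (hΓ : IsSuperGrading ev od Γ) : iSupIndep Γ := by
  classical
  exact DirectSum.IsInternal.submodule_iSupIndep hΓ.1

lemma iSup_eq_top (hΓ : IsSuperGrading ev od Γ) : iSup Γ = ⊤ := by
  classical
  exact DirectSum.IsInternal.submodule_iSup_eq_top hΓ.1

lemma mul_mem (hΓ : IsSuperGrading ev od Γ) {g h : G} {x y : A} (hx : x ∈ Γ g) (hy : y ∈ Γ h) :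
    x * y ∈ Γ (g * h) := hΓ.2.1 g h x y hx hy

lemma eq_zero_of_mem (hΓ : IsSuperGrading ev od Γ) {g h : G} (hgh : g ≠ h) {x : A}
    (hx : x ∈ Γ g) (hx' : x ∈ Γ h) : x = 0 :=
  Submodule.disjoint_def.1 (hΓ.iSupIndep.pairwiseDisjoint hgh) x hx hx'

lemma eq_zero_of_mem_of_eq_add (hΓ : IsSuperGrading ev od Γ) {g h k : G} (hgh : g ≠ h)
    (hgk : g ≠ k) {x y z : A} (hx : x ∈ Γ g) (hy : y ∈ Γ h) (hz : z ∈ Γ k) (hxyz : x = y + z) :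
    x = 0 := by
  refine Submodule.disjoint_def.1 (hΓ.iSupIndep g) x hx ?_
  rw [hxyz]
  exact add_mem (Submodule.mem_iSup_of_mem h (Submodule.mem_iSup_of_mem hgh.symm hy))
    (Submodule.mem_iSup_of_mem k (Submodule.mem_iSup_of_mem hgk.symm hz))

/-- A linear functional vanishing on `od` but not everywhere is nonzero on some homogeneous
element of `ev`. -/
lemma exists_mem_even (hΓ : IsSuperGrading ev od Γ) (f : A →ₗ[S] S) (hf : ∀ x ∈ od, f x = 0)
    (hne : ∃ x, f x ≠ 0) : ∃ g, ∃ x ∈ Γ g, x ∈ ev ∧ f x ≠ 0 := by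
  by_contra! hcon
  obtain ⟨x, hx⟩ := hne
  refine hx (Submodule.iSup_induction Γ (motive := fun y => f y = 0)
    (hΓ.iSup_eq_top ▸ Submodule.mem_top : x ∈ iSup Γ) (fun g y hy => ?_) (map_zero f)
    (fun y z hy hz => by rw [map_add, hy, hz, add_zero]))
  rw [hΓ.2.2 g] at hy
  obtain ⟨y, hye, z, hzo, rfl⟩ := Submodule.mem_sup.1 hy
  rw [map_add, hcon g y hye.1 hye.2, hf z hzo.2, add_zero]

/-- A linear functional vanishing on `ev` but not everywhere is nonzero on some homogeneous
element of `od`. -/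
lemma exists_mem_odd (hΓ : IsSuperGrading ev od Γ) (f : A →ₗ[S] S) (hf : ∀ x ∈ ev, f x = 0)
    (hne : ∃ x, f x ≠ 0) : ∃ g, ∃ x ∈ Γ g, x ∈ od ∧ f x ≠ 0 :=
  exists_mem_even (ev := od) (od := ev)
    ⟨hΓ.1, hΓ.2.1, fun g => by rw [sup_comm]; exact hΓ.2.2 g⟩ f hf hne

/-- A superalgebra automorphism sending a spanning family to homogeneous elements of prescribed
degrees identifies the corresponding gradings. -/
lemma gradIso_gradingOf (hΓ : IsSuperGrading ev od Γ) {n : ℕ} (w : Fin n → A) (d : Fin n → G)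
    (hw : ∀ x, x ∈ Submodule.span S (Set.range w)) (ψ : SuperAut S A ev od)
    (hψ : ∀ i, ψ.e (w i) ∈ Γ (d i)) : GradIso ev od Γ (gradingOf S w d) := by
  set Δ : G → Submodule S A := fun g => (gradingOf S w d g).map ψ.e.toLinearMap
  have hle : ∀ g, Δ g ≤ Γ g := by
    intro g
    refine (Submodule.map_span_le _ _ _).2 ?_
    rintro _ ⟨i, rfl, rfl⟩
    exact hψ i
  have htop : iSup Δ = ⊤ := by
    have hspan : Submodule.span S (Set.range w) ≤ ⨆ g, gradingOf S w d g := by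
      rw [Submodule.span_le]
      rintro _ ⟨i, rfl⟩
      exact Submodule.mem_iSup_of_mem (d i) (Submodule.subset_span ⟨i, rfl, rfl⟩)
    have hgr : ⨆ g, gradingOf S w d g = ⊤ := eq_top_iff.2 fun x _ => hspan (hw x)
    rw [← Submodule.map_iSup, hgr, Submodule.map_top, LinearMap.range_eq_top]
    exact ψ.e.surjective
  have heq : ∀ g, Δ g = Γ g := by
    intro g
    refine le_antisymm (hle g) ?_
    have hsup : Δ g ⊔ ⨆ j, ⨆ (_ : j ≠ g), Δ j = ⊤ := by
      rw [← htop, ← iSup_split_single]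
    have hbot : (⨆ j, ⨆ (_ : j ≠ g), Δ j) ⊓ Γ g = ⊥ := by
      rw [eq_bot_iff, ← (hΓ.iSupIndep g).eq_bot, inf_comm]
      exact inf_le_inf_left _ (iSup₂_mono fun j _ => hle j)
    calc Γ g = (Δ g ⊔ ⨆ j, ⨆ (_ : j ≠ g), Δ j) ⊓ Γ g := by rw [hsup, top_inf_eq]
      _ = Δ g ⊔ (⨆ j, ⨆ (_ : j ≠ g), Δ j) ⊓ Γ g := sup_inf_assoc_of_le _ (hle g)
      _ ≤ Δ g := by rw [hbot, sup_bot_eq]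
  refine ⟨ψ⁻¹, fun g => ?_⟩
  rw [← heq g]
  ext x
  constructor
  · rintro ⟨_, ⟨y, hy, rfl⟩, rfl⟩
    change ψ.e.symm (ψ.e y) ∈ _
    rwa [LinearEquiv.symm_apply_apply]
  · exact fun hx => ⟨ψ.e x, ⟨x, hx, rfl⟩, ψ.e.symm_apply_apply x⟩

end IsSuperGrading

end GradingLemmas

namespace K33A

variable {F : Type} [Field F]

lemma ext_coord {x y : K33A F F} (h0 : x 0 = y 0) (h1 : x 1 = y 1) (h2 : x 2 = y 2)
    (h3 : x 3 = y 3) (h4 : x 4 = y 4) (h5 : x 5 = y 5) : x = y := by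
  funext i
  fin_cases i <;> assumption

lemma mem_of_coord {U : Submodule F (K33A F F)} {x y : K33A F F} (hy : y ∈ U) (h0 : x 0 = y 0)
    (h1 : x 1 = y 1) (h2 : x 2 = y 2) (h3 : x 3 = y 3) (h4 : x 4 = y 4) (h5 : x 5 = y 5) :
    x ∈ U := ext_coord h0 h1 h2 h3 h4 h5 ▸ hy

lemma mul_apply_zero (x y : K33A F F) : (x * y) 0 = x 0 * y 0 + (x 1 * y 2 - x 2 * y 1) := rfl
lemma mul_apply_one (x y : K33A F F) : (x * y) 1 = 2⁻¹ * (x 0 * y 1 + y 0 * x 1) := rfl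
lemma mul_apply_two (x y : K33A F F) : (x * y) 2 = 2⁻¹ * (x 0 * y 2 + y 0 * x 2) := rfl
lemma mul_apply_three (x y : K33A F F) :
    (x * y) 3 = x 3 * y 3 + (x 4 * y 5 - x 5 * y 4) := rfl
lemma mul_apply_four (x y : K33A F F) : (x * y) 4 = 2⁻¹ * (x 3 * y 4 + y 3 * x 4) := rfl
lemma mul_apply_five (x y : K33A F F) : (x * y) 5 = 2⁻¹ * (x 3 * y 5 + y 3 * x 5) := rfl

lemma bv_apply (i j : Fin 6) : bv F i j = if j = i then 1 else 0 := by
  simp only [bv]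
  exact Pi.single_apply i (1 : F) j

lemma mem_even {x : K33A F F} : x ∈ even F F F ↔ x 1 = 0 ∧ x 2 = 0 ∧ x 4 = 0 ∧ x 5 = 0 := by
  constructor
  · intro h
    exact ⟨h 1 (by simp), h 2 (by simp), h 4 (by simp), h 5 (by simp)⟩
  · rintro ⟨h1, h2, h4, h5⟩ i hi
    fin_cases i <;> simp_all

lemma mem_odd {x : K33A F F} : x ∈ odd F F F ↔ x 0 = 0 ∧ x 3 = 0 := by
  constructor
  · intro h
    exact ⟨h 0 (by simp), h 3 (by simp)⟩
  · rintro ⟨h0, h3⟩ i hi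
    fin_cases i <;> simp_all

/-- The linear functional with coefficients `c` in the standard basis. -/
def functional (c : Fin 6 → F) : K33A F F →ₗ[F] F where
  toFun x := ∑ i, c i * x i
  map_add' x y := by simp [mul_add, Finset.sum_add_distrib]
  map_smul' r x := by simp [Finset.mul_sum, mul_left_comm]

lemma functional_apply (c : Fin 6 → F) (x : K33A F F) :
    functional c x = c 0 * x 0 + c 1 * x 1 + c 2 * x 2 + c 3 * x 3 + c 4 * x 4 + c 5 * x 5 := by
  simp [functional, Fin.sum_univ_succ]
  ring

/-- The coordinates of the image of `x` under the linear map fixing the even part and sending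
`(u,u)` to `p` and `(v,v)` to `q` componentwise. -/
def oddMapFun (p q x : K33A F F) : K33A F F :=
  ![x 0, x 1 * p 1 + x 2 * q 1, x 1 * p 2 + x 2 * q 2,
    x 3, x 4 * p 4 + x 5 * q 4, x 4 * p 5 + x 5 * q 5]

section

variable (p q x : K33A F F)

lemma oddMapFun_zero : oddMapFun p q x 0 = x 0 := rfl
lemma oddMapFun_one : oddMapFun p q x 1 = x 1 * p 1 + x 2 * q 1 := rfl
lemma oddMapFun_two : oddMapFun p q x 2 = x 1 * p 2 + x 2 * q 2 := rfl
lemma oddMapFun_three : oddMapFun p q x 3 = x 3 := rfl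
lemma oddMapFun_four : oddMapFun p q x 4 = x 4 * p 4 + x 5 * q 4 := rfl
lemma oddMapFun_five : oddMapFun p q x 5 = x 4 * p 5 + x 5 * q 5 := rfl

end

/-- The linear map fixing the even part and sending `(u,u)` to `p` and `(v,v)` to `q`
componentwise. -/
def oddMap (p q : K33A F F) : K33A F F →ₗ[F] K33A F F where
  toFun := oddMapFun p q
  map_add' x y := by
    apply ext_coord <;> simp only [oddMapFun_zero, oddMapFun_one, oddMapFun_two, oddMapFun_three,
      oddMapFun_four, oddMapFun_five, add_apply] <;> ring
  map_smul' c x := by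
    apply ext_coord <;> simp only [oddMapFun_zero, oddMapFun_one, oddMapFun_two, oddMapFun_three,
      oddMapFun_four, oddMapFun_five, smul_apply, smul_eq_mul, RingHom.id_apply] <;> ring

lemma oddMap_apply (p q x : K33A F F) : oddMap p q x = oddMapFun p q x := rfl

lemma oddMap_mem_even (p q : K33A F F) {x : K33A F F} (hx : x ∈ even F F F) :
    oddMap p q x ∈ even F F F := by
  obtain ⟨h1, h2, h4, h5⟩ := mem_even.1 hx
  simp [mem_even, oddMap_apply, oddMapFun_one, oddMapFun_two, oddMapFun_four, oddMapFun_five,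
    h1, h2, h4, h5]

lemma oddMap_mem_odd (p q : K33A F F) {x : K33A F F} (hx : x ∈ odd F F F) :
    oddMap p q x ∈ odd F F F := by
  obtain ⟨h0, h3⟩ := mem_odd.1 hx
  simp [mem_odd, oddMap_apply, oddMapFun_zero, oddMapFun_three, h0, h3]

lemma oddMap_mul {p q : K33A F F} (h : p 1 * q 2 - p 2 * q 1 = 1)
    (h' : p 4 * q 5 - p 5 * q 4 = 1) (x y : K33A F F) :
    oddMap p q (x * y) = oddMap p q x * oddMap p q y := by
  apply ext_coord <;> simp only [oddMap_apply, oddMapFun_zero, oddMapFun_one, oddMapFun_two,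
    oddMapFun_three, oddMapFun_four, oddMapFun_five, mul_apply_zero, mul_apply_one,
    mul_apply_two, mul_apply_three, mul_apply_four, mul_apply_five]
  · linear_combination -(x 1 * y 2 - x 2 * y 1) * h
  · ring
  · ring
  · linear_combination -(x 4 * y 5 - x 5 * y 4) * h'
  · ring
  · ring

/-- The image of `(u,u)` under the inverse of `oddMap p q`. -/
def invLeft (p q : K33A F F) : K33A F F := ![0, q 2, -p 2, 0, q 5, -p 5]

/-- The image of `(v,v)` under the inverse of `oddMap p q`. -/
def invRight (p q : K33A F F) : K33A F F := ![0, -q 1, p 1, 0, -q 4, p 4]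

lemma oddMap_oddMap_inv {p q : K33A F F} (h : p 1 * q 2 - p 2 * q 1 = 1)
    (h' : p 4 * q 5 - p 5 * q 4 = 1) (x : K33A F F) :
    oddMap p q (oddMap (invLeft p q) (invRight p q) x) = x := by
  apply ext_coord <;> simp only [oddMap_apply, oddMapFun_zero, oddMapFun_one, oddMapFun_two,
    oddMapFun_three, oddMapFun_four, oddMapFun_five] <;> simp [invLeft, invRight]
  · linear_combination x 1 * h
  · linear_combination x 2 * h
  · linear_combination x 4 * h'
  · linear_combination x 5 * h'

lemma oddMap_inv_oddMap {p q : K33A F F} (h : p 1 * q 2 - p 2 * q 1 = 1)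
    (h' : p 4 * q 5 - p 5 * q 4 = 1) (x : K33A F F) :
    oddMap (invLeft p q) (invRight p q) (oddMap p q x) = x := by
  apply ext_coord <;> simp only [oddMap_apply, oddMapFun_zero, oddMapFun_one, oddMapFun_two,
    oddMapFun_three, oddMapFun_four, oddMapFun_five] <;> simp [invLeft, invRight]
  · linear_combination x 1 * h
  · linear_combination x 2 * h
  · linear_combination x 4 * h'
  · linear_combination x 5 * h'

/-- The automorphism of `K₃ × K₃` fixing the even part and sending `(u,u)` to `p` and `(v,v)` to
`q`, where both components of `(p, q)` are symplectic bases. -/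
def symplecticAut (p q : K33A F F) (h : p 1 * q 2 - p 2 * q 1 = 1)
    (h' : p 4 * q 5 - p 5 * q 4 = 1) : SuperAut F (K33A F F) (even F F F) (odd F F F) where
  e := LinearEquiv.ofLinearMap (oddMap p q) (oddMap (invLeft p q) (invRight p q))
    (LinearMap.ext (oddMap_oddMap_inv h h')) (LinearMap.ext (oddMap_inv_oddMap h h'))
  map_mul' := oddMap_mul h h'
  map_even := le_antisymm (Submodule.map_le_iff_le_comap.2 fun _ hx => oddMap_mem_even p q hx)
    fun x hx => ⟨_, oddMap_mem_even _ _ hx, oddMap_oddMap_inv h h' x⟩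
  map_odd := le_antisymm (Submodule.map_le_iff_le_comap.2 fun _ hx => oddMap_mem_odd p q hx)
    fun x hx => ⟨_, oddMap_mem_odd _ _ hx, oddMap_oddMap_inv h h' x⟩

lemma symplecticAut_apply (p q : K33A F F) (h : p 1 * q 2 - p 2 * q 1 = 1)
    (h' : p 4 * q 5 - p 5 * q 4 = 1) (x : K33A F F) :
    (symplecticAut p q h h').e x = oddMapFun p q x := rfl

variable {G : Type} [CommGroup G] {Γ : G → Submodule F (K33A F F)}

/-- Either the even part is homogeneous of degree `e`, or `(a,a)` and `(a,-a)` are homogeneous,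
the latter of degree of order two. -/
lemma even_degree (hΓ : IsSuperGrading (even F F F) (odd F F F) Γ) :
    (bv F 0 ∈ Γ 1 ∧ bv F 3 ∈ Γ 1) ∨
      ∃ h : G, h * h = 1 ∧ h ≠ 1 ∧ bv F 0 + bv F 3 ∈ Γ 1 ∧ bv F 0 - bv F 3 ∈ Γ h := by
  by_cases htriv : ∀ g, ∀ x ∈ Γ g, x ∈ even F F F → x ≠ 0 → g = 1
  · left
    obtain ⟨g, x, hx, hxe, hx0⟩ := hΓ.exists_mem_even (functional ![1, 0, 0, 0, 0, 0])
      (fun x hx => by simp [functional_apply, (mem_odd.1 hx).1])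
      ⟨bv F 0, by simp [functional_apply, bv_apply]⟩
    simp [functional_apply] at hx0
    obtain ⟨g', y, hy, hye, hy0⟩ := hΓ.exists_mem_even (functional ![-x 3, 0, 0, x 0, 0, 0])
      (fun x hx => by simp [functional_apply, (mem_odd.1 hx).1, (mem_odd.1 hx).2])
      ⟨bv F 3, by simpa [functional_apply, bv_apply] using hx0⟩
    simp [functional_apply] at hy0
    obtain rfl := htriv g x hx hxe (fun h => hx0 (by simp [h]))
    obtain rfl := htriv g' y hy hye (fun h => hy0 (by simp [h]))
    obtain ⟨x1, x2, x4, x5⟩ := mem_even.1 hxe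
    obtain ⟨y1, y2, y4, y5⟩ := mem_even.1 hye
    obtain ⟨D, hD⟩ : ∃ D, D = -(x 3 * y 0) + x 0 * y 3 := ⟨_, rfl⟩
    rw [← hD] at hy0
    have h0 : bv F 0 = (y 3 / D) • x + (-x 3 / D) • y := by
      apply ext_coord <;> simp [bv_apply, x1, x2, x4, x5, y1, y2, y4, y5] <;> field_simp
      · linear_combination hD
      · ring
    have h3 : bv F 3 = (-y 0 / D) • x + (x 0 / D) • y := by
      apply ext_coord <;> simp [bv_apply, x1, x2, x4, x5, y1, y2, y4, y5] <;> field_simp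
      · ring
      · linear_combination hD
    exact ⟨h0 ▸ add_mem (Submodule.smul_mem _ _ hx) (Submodule.smul_mem _ _ hy),
      h3 ▸ add_mem (Submodule.smul_mem _ _ hx) (Submodule.smul_mem _ _ hy)⟩
  · right
    push Not at htriv
    obtain ⟨h, x, hx, hxe, hx0, h1⟩ := htriv
    obtain ⟨x1, x2, x4, x5⟩ := mem_even.1 hxe
    have hsq := hΓ.mul_mem hx hx
    have hcube := hΓ.mul_mem hsq hx
    have hsq_ne : h ≠ h * h := by simpa using h1
    have hdep : ∀ a : F, a • x = x * x → a • x = 0 := fun a hax =>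
      hΓ.eq_zero_of_mem hsq_ne (Submodule.smul_mem _ _ hx) (hax ▸ hsq)
    have hx0' : x 0 ≠ 0 := by
      intro h0
      have h3 := congrFun (hdep (x 3) (by
        apply ext_coord <;> simp [mul_apply_zero, mul_apply_one, mul_apply_two,
          mul_apply_three, mul_apply_four, mul_apply_five, h0, x1, x2, x4, x5])) 3
      simp at h3
      exact hx0 (ext_coord h0 x1 x2 h3 x4 x5)
    have hx3' : x 3 ≠ 0 := by
      intro h3
      have h0 := congrFun (hdep (x 0) (by
        apply ext_coord <;> simp [mul_apply_zero, mul_apply_one, mul_apply_two,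
          mul_apply_three, mul_apply_four, mul_apply_five, h3, x1, x2, x4, x5])) 0
      simp at h0
      exact hx0 (ext_coord h0 x1 x2 h3 x4 x5)
    have hcayley : (x 0 * x 3) • x = (x 0 + x 3) • (x * x) + (-1 : F) • (x * x * x) := by
      apply ext_coord <;> simp [mul_apply_zero, mul_apply_one, mul_apply_two, mul_apply_three,
        mul_apply_four, mul_apply_five, *] <;> ring
    have hh : h = h * h * h := by
      by_contra hcon
      have := hΓ.eq_zero_of_mem_of_eq_add hsq_ne hcon (Submodule.smul_mem _ _ hx)
        (Submodule.smul_mem _ _ hsq) (Submodule.smul_mem _ _ hcube) hcayley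
      exact hx0 ((smul_eq_zero_iff_right (mul_ne_zero hx0' hx3')).1 this)
    have hhh : h * h = 1 := by simpa using hh
    have hsum : x 3 = -x 0 := by
      have hmem : (x 0 + x 3) • (x * x) ∈ Γ h := by
        have : (x 0 + x 3) • (x * x) = (x 0 * x 3) • x + x * x * x := by
          rw [hcayley, neg_one_smul]; abel
        rw [this]
        exact add_mem (Submodule.smul_mem _ _ hx) (by rw [hh]; exact hcube)
      have := congrFun (hΓ.eq_zero_of_mem hsq_ne hmem (Submodule.smul_mem _ _ hsq)) 0
      simp [mul_apply_zero, x1, x2, hx0'] at this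
      linear_combination this
    refine ⟨h, hhh, h1, ?_, ?_⟩
    · have : bv F 0 + bv F 3 = (x 0 * x 0)⁻¹ • (x * x) := by
        apply ext_coord <;> simp [bv_apply, mul_apply_zero, mul_apply_one, mul_apply_two,
          mul_apply_three, mul_apply_four, mul_apply_five, *] <;> field_simp
      rw [this, ← hhh]
      exact Submodule.smul_mem _ _ hsq
    · have : bv F 0 - bv F 3 = (x 0)⁻¹ • x := by
        apply ext_coord <;> simp [bv_apply, *]
      rw [this]
      exact Submodule.smul_mem _ _ hx

lemma two_smul_bv_mul (hchar : (2 : F) ≠ 0) {i j k : Fin 6}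
    (hijk : (i, j, k) = (0, 1, 2) ∨ (i, j, k) = (3, 4, 5)) {x : K33A F F}
    (hx : x ∈ odd F F F) : (2 : F) • (bv F i * x) = x j • bv F j + x k • bv F k := by
  obtain ⟨h0, h3⟩ := mem_odd.1 hx
  simp only [Prod.mk.injEq] at hijk
  obtain ⟨rfl, rfl, rfl⟩ | ⟨rfl, rfl, rfl⟩ := hijk <;> apply ext_coord <;>
    simp [bv_apply, mul_apply_zero, mul_apply_one, mul_apply_two, mul_apply_three,
      mul_apply_four, mul_apply_five, h0, h3, hchar]

lemma symplectic_mul {i j k : Fin 6}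
    (hijk : (i, j, k) = (0, 1, 2) ∨ (i, j, k) = (3, 4, 5)) (a b c d : F) :
    (a • bv F j + b • bv F k) * (c • bv F j + d • bv F k) = (a * d - b * c) • bv F i := by
  simp only [Prod.mk.injEq] at hijk
  obtain ⟨rfl, rfl, rfl⟩ | ⟨rfl, rfl, rfl⟩ := hijk <;> apply ext_coord <;>
    simp [bv_apply, mul_apply_zero, mul_apply_one, mul_apply_two, mul_apply_three,
      mul_apply_four, mul_apply_five]

/-- If the idempotent of a factor has degree `e`, then the odd part of this factor has a
homogeneous symplectic basis. -/
lemma exists_symplectic_basis (hchar : (2 : F) ≠ 0)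
    (hΓ : IsSuperGrading (even F F F) (odd F F F) Γ) {i j k : Fin 6}
    (hijk : (i, j, k) = (0, 1, 2) ∨ (i, j, k) = (3, 4, 5)) (hi : bv F i ∈ Γ 1) :
    ∃ g : G, ∃ a b c d : F, a * d - b * c = 1 ∧ a • bv F j + b • bv F k ∈ Γ g ∧
      c • bv F j + d • bv F k ∈ Γ g⁻¹ := by
  have hproj : ∀ {g x}, x ∈ Γ g → x ∈ odd F F F → x j • bv F j + x k • bv F k ∈ Γ g := by
    intro g x hx hxo
    rw [← two_smul_bv_mul hchar hijk hxo]
    exact Submodule.smul_mem _ _ (by simpa using hΓ.mul_mem hi hx)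
  have hcoord : ∀ a b : F, (∃ y : K33A F F, a * y k - b * y j ≠ 0) →
      ∃ g, ∃ x ∈ Γ g, x ∈ odd F F F ∧ a * x k - b * x j ≠ 0 := by
    rintro a b ⟨y, hy⟩
    simp only [Prod.mk.injEq] at hijk
    obtain ⟨rfl, rfl, rfl⟩ | ⟨rfl, rfl, rfl⟩ := hijk
    · obtain ⟨g, x, hx, hxo, hne⟩ := hΓ.exists_mem_odd (functional ![0, -b, a, 0, 0, 0])
        (fun x hx => by simp [functional_apply, mem_even.1 hx])
        ⟨y, fun h => hy (by simp [functional_apply] at h; linear_combination h)⟩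
      exact ⟨g, x, hx, hxo, fun h => hne (by simp [functional_apply]; linear_combination h)⟩
    · obtain ⟨g, x, hx, hxo, hne⟩ := hΓ.exists_mem_odd (functional ![0, 0, 0, 0, -b, a])
        (fun x hx => by simp [functional_apply, mem_even.1 hx])
        ⟨y, fun h => hy (by simp [functional_apply] at h; linear_combination h)⟩
      exact ⟨g, x, hx, hxo, fun h => hne (by simp [functional_apply]; linear_combination h)⟩
  have hjk : j ≠ k := by
    simp only [Prod.mk.injEq] at hijk
    obtain ⟨rfl, rfl, rfl⟩ | ⟨rfl, rfl, rfl⟩ := hijk <;> decide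
  obtain ⟨g, x, hx, hxo, hxj⟩ := hcoord 0 1 ⟨bv F j, by simp [bv_apply]⟩
  replace hxj : x j ≠ 0 := by simpa using hxj
  obtain ⟨g', y, hy, hyo, hD⟩ := hcoord (x j) (x k) ⟨bv F k, by simp [bv_apply, hjk, hxj]⟩
  obtain ⟨D, hD'⟩ : ∃ D, D = x j * y k - x k * y j := ⟨_, rfl⟩
  rw [← hD'] at hD
  have hy' : (y j / D) • bv F j + (y k / D) • bv F k ∈ Γ g' := by
    have : (y j / D) • bv F j + (y k / D) • bv F k = D⁻¹ • (y j • bv F j + y k • bv F k) := by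
      rw [smul_add, smul_smul, smul_smul, div_eq_inv_mul, div_eq_inv_mul]
    rw [this]
    exact Submodule.smul_mem _ _ (hproj hy hyo)
  have hdet : x j * (y k / D) - x k * (y j / D) = 1 := by
    field_simp
    exact hD'.symm
  have hprod := hΓ.mul_mem (hproj hx hxo) hy'
  rw [symplectic_mul hijk, hdet, one_smul] at hprod
  have hgg : 1 = g * g' := by
    by_contra hne
    have := congrFun (hΓ.eq_zero_of_mem hne hi hprod) i
    simp [bv_apply] at this
  exact ⟨g, x j, x k, y j / D, y k / D, hdet, hproj hx hxo,
    eq_inv_of_mul_eq_one_right hgg.symm ▸ hy'⟩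

/-- If `(a,-a)` has degree `h ≠ e`, then the odd part has a homogeneous pair `p, q` of opposite
degrees both of whose components are symplectic bases. -/
lemma exists_diagonal_symplectic_basis (hchar : (2 : F) ≠ 0)
    (hΓ : IsSuperGrading (even F F F) (odd F F F) Γ) {h : G} (hh : h * h = 1) (h1 : h ≠ 1)
    (hadd : bv F 0 + bv F 3 ∈ Γ 1) (hsub : bv F 0 - bv F 3 ∈ Γ h) :
    ∃ g : G, ∃ p ∈ Γ g, ∃ q ∈ Γ g⁻¹, p ∈ odd F F F ∧ q ∈ odd F F F ∧
      p 1 * q 2 - p 2 * q 1 = 1 ∧ p 4 * q 5 - p 5 * q 4 = 1 := by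
  obtain ⟨g, p, hp, hpo, hp1⟩ := hΓ.exists_mem_odd (functional ![0, 1, 0, 0, 0, 0])
    (fun x hx => by simp [functional_apply, mem_even.1 hx])
    ⟨bv F 1, by simp [functional_apply, bv_apply]⟩
  replace hp1 : p 1 ≠ 0 := by simpa [functional_apply] using hp1
  obtain ⟨g', r, hr, hro, hr1⟩ := hΓ.exists_mem_odd (functional ![0, -p 2, p 1, 0, 0, 0])
    (fun x hx => by simp [functional_apply, mem_even.1 hx])
    ⟨bv F 2, by simpa [functional_apply, bv_apply] using hp1⟩
  obtain ⟨c, hc⟩ : ∃ c, c = p 1 * r 2 - p 2 * r 1 := ⟨_, rfl⟩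
  obtain ⟨d, hd⟩ : ∃ d, d = p 4 * r 5 - p 5 * r 4 := ⟨_, rfl⟩
  replace hr1 : c ≠ 0 := fun h0 => hr1 (by
    simp [functional_apply]
    linear_combination h0 - hc)
  obtain ⟨hp0, hp3⟩ := mem_odd.1 hpo
  obtain ⟨hr0, hr3⟩ := mem_odd.1 hro
  have hprod : p * r = ((c + d) / 2) • (bv F 0 + bv F 3) + ((c - d) / 2) • (bv F 0 - bv F 3) := by
    apply ext_coord <;> simp [bv_apply, mul_apply_zero, mul_apply_one, mul_apply_two,
      mul_apply_three, mul_apply_four, mul_apply_five, hp0, hp3, hr0, hr3] <;> field_simp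
    · linear_combination -2 * hc
    · linear_combination -2 * hd
  have hpr := hΓ.mul_mem hp hr
  have hadd' := Submodule.smul_mem (Γ 1) ((c + d) / 2) hadd
  have hsub' := Submodule.smul_mem (Γ h) ((c - d) / 2) hsub
  by_cases hgg : g * g' = 1
  · have hcd : c = d := by
      have hmem : ((c - d) / 2) • (bv F 0 - bv F 3) ∈ Γ 1 := by
        rw [eq_sub_of_add_eq' hprod.symm]
        exact sub_mem (hgg ▸ hpr) hadd'
      have := congrFun (hΓ.eq_zero_of_mem h1 hsub' hmem) 0
      simp [bv_apply, hchar] at this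
      linear_combination this
    refine ⟨g, p, hp, c⁻¹ • r, ?_, hpo, Submodule.smul_mem _ _ hro, ?_, ?_⟩
    · rw [← eq_inv_of_mul_eq_one_right hgg]
      exact Submodule.smul_mem _ _ hr
    · simp only [smul_apply, smul_eq_mul]
      field_simp
      exact hc.symm
    · simp only [smul_apply, smul_eq_mul]
      field_simp
      exact (hcd.trans hd).symm
  · have hgh : g * g' = h := by
      by_contra hne
      have := congrFun (hΓ.eq_zero_of_mem_of_eq_add hgg hne hpr hadd' hsub' hprod) 0
      rw [mul_apply_zero, ← hc, hp0] at this
      simp [hr1] at this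
    have hcd : c = -d := by
      have hmem : ((c + d) / 2) • (bv F 0 + bv F 3) ∈ Γ h := by
        rw [eq_sub_of_add_eq hprod.symm]
        exact sub_mem (hgh ▸ hpr) hsub'
      have := congrFun (hΓ.eq_zero_of_mem h1.symm hadd' hmem) 0
      simp [bv_apply, hchar] at this
      linear_combination this
    have hinv : h * g' = g⁻¹ := by
      refine eq_inv_of_mul_eq_one_right ?_
      rw [mul_left_comm, hgh, hh]
    refine ⟨g, p, hp, (2 * c⁻¹) • ((bv F 0 - bv F 3) * r), ?_, hpo, ?_, ?_, ?_⟩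
    · rw [← hinv]
      exact Submodule.smul_mem _ _ (hΓ.mul_mem hsub hr)
    · refine Submodule.smul_mem _ _ (mem_odd.2 ?_)
      simp [mul_apply_zero, mul_apply_three, bv_apply, hr0, hr3]
    · simp [mul_apply_one, mul_apply_two, bv_apply]
      field_simp
      linear_combination -hc
    · simp [mul_apply_four, mul_apply_five, bv_apply]
      field_simp
      linear_combination hd - hcd

end K33A

end Kac

/-! ### STATEMENT 12 -/

open Kac in
/-- Every grading of `K₃ × K₃` (realized as `K33A F F`) by an abelian group
`G` is isomorphic to `Γ¹(G; g₁, g₂)` for some `g₁ g₂`, or to `Γ²(G; g, h)`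
for some `g, h` with `h² = e ≠ h`. -/
theorem gradings_on_K3xK3 (F : Type) [Field F] (hchar : (2 : F) ≠ 0)
    (G : Type) [CommGroup G] (Γ : G → Submodule F (K33A F F))
    (hΓ : IsSuperGrading (K33A.even F F F) (K33A.odd F F F) Γ) :
    (∃ g1 g2 : G, GradIso (K33A.even F F F) (K33A.odd F F F) Γ (K33A.gamma1 F g1 g2)) ∨
    (∃ g h : G, h * h = 1 ∧ h ≠ 1 ∧
      GradIso (K33A.even F F F) (K33A.odd F F F) Γ (K33A.gamma2 F g h)) := by
  obtain ⟨h0, h3⟩ | ⟨h, hh, h1, hadd, hsub⟩ := K33A.even_degree hΓ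
  · left
    obtain ⟨g1, a, b, c, d, hdet, hp, hq⟩ :=
      K33A.exists_symplectic_basis hchar hΓ (i := 0) (Or.inl rfl) h0
    obtain ⟨g2, a', b', c', d', hdet', hp', hq'⟩ :=
      K33A.exists_symplectic_basis hchar hΓ (i := 3) (Or.inr rfl) h3
    obtain ⟨p, p1, p2, p4, p5⟩ : ∃ p : K33A F F, p 1 = a ∧ p 2 = b ∧ p 4 = a' ∧ p 5 = b' :=
      ⟨![0, a, b, 0, a', b'], rfl, rfl, rfl, rfl⟩
    obtain ⟨q, q1, q2, q4, q5⟩ : ∃ q : K33A F F, q 1 = c ∧ q 2 = d ∧ q 4 = c' ∧ q 5 = d' :=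
      ⟨![0, c, d, 0, c', d'], rfl, rfl, rfl, rfl⟩
    refine ⟨g1, g2, hΓ.gradIso_gradingOf _ _ (fun x => ?_)
      (K33A.symplecticAut p q (by rwa [p1, p2, q1, q2]) (by rwa [p4, p5, q4, q5])) (fun i => ?_)⟩
    · have hx : x = ∑ i, x i • K33A.bv F i := by
        simp only [Fin.sum_univ_succ]
        apply K33A.ext_coord <;> simp [K33A.bv_apply]
      rw [hx]
      exact sum_mem fun i _ => Submodule.smul_mem _ _ (Submodule.subset_span ⟨i, rfl⟩)
    · rw [K33A.symplecticAut_apply]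
      fin_cases i
      · refine K33A.mem_of_coord h0 ?_ ?_ ?_ ?_ ?_ ?_ <;>
          simp [K33A.oddMapFun, K33A.bv_apply]
      · refine K33A.mem_of_coord hp ?_ ?_ ?_ ?_ ?_ ?_ <;>
          simp [K33A.oddMapFun, K33A.bv_apply, p1, p2]
      · refine K33A.mem_of_coord hq ?_ ?_ ?_ ?_ ?_ ?_ <;>
          simp [K33A.oddMapFun, K33A.bv_apply, q1, q2]
      · refine K33A.mem_of_coord h3 ?_ ?_ ?_ ?_ ?_ ?_ <;>
          simp [K33A.oddMapFun, K33A.bv_apply]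
      · refine K33A.mem_of_coord hp' ?_ ?_ ?_ ?_ ?_ ?_ <;>
          simp [K33A.oddMapFun, K33A.bv_apply, p4, p5]
      · refine K33A.mem_of_coord hq' ?_ ?_ ?_ ?_ ?_ ?_ <;>
          simp [K33A.oddMapFun, K33A.bv_apply, q4, q5]
  · right
    obtain ⟨g, p, hp, q, hq, hpo, hqo, hdet, hdet'⟩ :=
      K33A.exists_diagonal_symplectic_basis hchar hΓ hh h1 hadd hsub
    obtain ⟨p0, p3⟩ := K33A.mem_odd.1 hpo
    obtain ⟨q0, q3⟩ := K33A.mem_odd.1 hqo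
    refine ⟨g, h, hh, h1, hΓ.gradIso_gradingOf _ _ (fun x => ?_)
      (K33A.symplecticAut p q hdet hdet') (fun i => ?_)⟩
    · set w : Fin 6 → K33A F F :=
        ![K33A.bv F 0 + K33A.bv F 3, K33A.bv F 0 - K33A.bv F 3,
          K33A.bv F 1 + K33A.bv F 4, K33A.bv F 2 + K33A.bv F 5,
          K33A.bv F 1 - K33A.bv F 4, K33A.bv F 2 - K33A.bv F 5] with hw
      have hx : x = ∑ i, (![(x 0 + x 3) / 2, (x 0 - x 3) / 2, (x 1 + x 4) / 2, (x 2 + x 5) / 2,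
          (x 1 - x 4) / 2, (x 2 - x 5) / 2] : Fin 6 → F) i • w i := by
        simp only [Fin.sum_univ_succ, hw]
        apply K33A.ext_coord <;> simp [K33A.bv_apply] <;> field_simp <;> ring
      rw [hx]
      exact sum_mem fun i _ => Submodule.smul_mem _ _ (Submodule.subset_span ⟨i, rfl⟩)
    · have hp' : (2 : F) • ((K33A.bv F 0 - K33A.bv F 3) * p) ∈ Γ (g * h) :=
        Submodule.smul_mem _ _ (mul_comm h g ▸ hΓ.mul_mem hsub hp)
      have hq' : (2 : F) • ((K33A.bv F 0 - K33A.bv F 3) * q) ∈ Γ (g⁻¹ * h) :=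
        Submodule.smul_mem _ _ (mul_comm h g⁻¹ ▸ hΓ.mul_mem hsub hq)
      rw [K33A.symplecticAut_apply]
      fin_cases i
      · refine K33A.mem_of_coord hadd ?_ ?_ ?_ ?_ ?_ ?_ <;>
          simp [K33A.oddMapFun, K33A.bv_apply]
      · refine K33A.mem_of_coord hsub ?_ ?_ ?_ ?_ ?_ ?_ <;>
          simp [K33A.oddMapFun, K33A.bv_apply]
      · refine K33A.mem_of_coord hp ?_ ?_ ?_ ?_ ?_ ?_ <;>
          simp [K33A.oddMapFun, K33A.bv_apply, p0, p3]
      · refine K33A.mem_of_coord hq ?_ ?_ ?_ ?_ ?_ ?_ <;>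
          simp [K33A.oddMapFun, K33A.bv_apply, q0, q3]
      · refine K33A.mem_of_coord hp' ?_ ?_ ?_ ?_ ?_ ?_ <;>
          simp [K33A.oddMapFun, K33A.bv_apply, K33A.mul_apply_zero,
          K33A.mul_apply_one, K33A.mul_apply_two, K33A.mul_apply_three, K33A.mul_apply_four,
          K33A.mul_apply_five, p0, p3, hchar]
      · refine K33A.mem_of_coord hq' ?_ ?_ ?_ ?_ ?_ ?_ <;>
          simp [K33A.oddMapFun, K33A.bv_apply, K33A.mul_apply_zero,
          K33A.mul_apply_one, K33A.mul_apply_two, K33A.mul_apply_three, K33A.mul_apply_four,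
          K33A.mul_apply_five, q0, q3, hchar]
end
end

section
/- Let G be an abelian group with neutral element e. For any g₁,g₂ ∈ G and any g,h ∈ G with h² = e ≠ h, the gradings Γ¹(G;g₁,g₂) and Γ²(G;g,h) on K₃ × K₃ are not isomorphic. -/
open scoped TensorProduct
noncomputable section
namespace Kac

lemma K33A.bv_apply_s15 (F : Type) [Field F] (i j : Fin 6) :
    K33A.bv F i j = if j = i then 1 else 0 := Pi.single_apply i 1 j

/-- Components of `Γ¹` of nontrivial degree have no even coordinates. -/
lemma K33A.gamma1_le_odd (F : Type) [Field F] {G : Type} [CommGroup G] (g1 g2 : G) {h : G}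
    (hne : h ≠ 1) : K33A.gamma1 F g1 g2 h ≤ K33A.odd F F F := by
  refine Submodule.span_le.2 ?_
  rintro _ ⟨i, hi, rfl⟩ j hj
  have hij : j ≠ i := by
    rintro rfl
    fin_cases j <;> simp_all [eq_comm]
  exact Pi.single_eq_of_ne hij 1

lemma K33A.even_inf_odd (F : Type) [Field F] : K33A.even F F F ⊓ K33A.odd F F F = ⊥ := by
  refine (Submodule.eq_bot_iff _).2 fun x hx => funext fun i => ?_
  by_cases hi : i ∈ ({0, 3} : Set (Fin 6))
  · refine hx.2 i ?_
    rcases hi with rfl | rfl <;> simp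
  · exact hx.1 i hi

end Kac

/-! ### STATEMENT 15 -/

open Kac in
/-- No grading `Γ¹(G; g₁, g₂)` on `K₃ × K₃` is isomorphic to a grading
`Γ²(G; g, h)`. -/
theorem gamma1_not_iso_gamma2 (F : Type) [Field F] (hchar : (2 : F) ≠ 0)
    (G : Type) [CommGroup G] (g1 g2 g h : G) (hh : h * h = 1) (hne : h ≠ 1) :
    ¬ GradIso (K33A.even F F F) (K33A.odd F F F)
        (K33A.gamma1 F g1 g2) (K33A.gamma2 F g h) := by
  rintro ⟨φ, hφ⟩
  set x : K33A F F := K33A.bv F 0 - K33A.bv F 3 with hx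
  have hx_mem : x ∈ K33A.gamma2 F g h h := Submodule.subset_span ⟨1, rfl, rfl⟩
  have hx_even : x ∈ K33A.even F F F := by
    intro i hi
    rw [hx, K33A.sub_apply, K33A.bv_apply_s15, K33A.bv_apply_s15]
    simp only [Set.mem_insert_iff, Set.mem_singleton_iff, not_or] at hi
    simp [hi]
  rw [← hφ h] at hx_mem
  rw [← φ.map_even] at hx_even
  obtain ⟨y, hy, hyx⟩ := hx_mem
  obtain ⟨z, hz, hzx⟩ := hx_even
  obtain rfl : z = y := φ.e.injective (hzx.trans hyx.symm)
  have hz0 : z ∈ K33A.even F F F ⊓ K33A.odd F F F :=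
    ⟨hz, K33A.gamma1_le_odd F g1 g2 hne hy⟩
  rw [K33A.even_inf_odd, Submodule.mem_bot] at hz0
  have hx0 : x = 0 := by rw [← hzx, hz0, map_zero]
  have h0 := congrFun hx0 0
  simp [hx, K33A.sub_apply, K33A.bv_apply_s15] at h0
end
end
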